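/- Fix γ > 0. The fixed-point equation β² = (1/(γ+1))·G(β)² (i.e., with zero communication cost c = 0) has exactly one solution β* in [0,∞), and this solution is strictly positive: β* > 0. (Remark 10: even when communication is free, the optimal threshold is strictly positive.) -/

import Mathlib

open MeasureTheory Set

/-- The mean excess `E[X - β | X > β]` of a random variable with density `p`. -/
noncomputable def meanExcess (p : ℝ → ℝ) (β : ℝ) : ℝ :=
  (∫ x in Ioi β, x * p x) / (∫ x in Ioi β, p x) - β

theorem integrable_id_mul_of_integrable_sq_mul {p : ℝ → ℝ} (hp : Integrable p)
    (hnonneg : ∀ x, 0 ≤ p x) (hsq : Integrable (fun x => x ^ 2 * p x)) :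
    Integrable (fun x => x * p x) := by
  refine (hp.add hsq).mono' (measurable_id.aestronglyMeasurable.mul hp.aestronglyMeasurable)
    (Filter.Eventually.of_forall fun x => ?_)
  have h : |x| ≤ 1 + x ^ 2 := abs_le.2 ⟨by nlinarith, by nlinarith⟩
  have h' := mul_le_mul_of_nonneg_right h (hnonneg x)
  simp only [Real.norm_eq_abs, abs_mul, abs_of_nonneg (hnonneg x), Pi.add_apply]
  linarith

theorem setIntegral_Ioi_pos {f : ℝ → ℝ} (hf : Integrable f) {a : ℝ}
    (hpos : ∀ x ∈ Ioi a, 0 < f x) : 0 < ∫ x in Ioi a, f x := by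
  rw [setIntegral_pos_iff_support_of_nonneg_ae
    ((ae_restrict_iff' measurableSet_Ioi).2
      (Filter.Eventually.of_forall fun x hx => (hpos x hx).le)) hf.integrableOn]
  have h : Function.support f ∩ Ioi a = Ioi a :=
    inter_eq_right.2 fun x hx => (hpos x hx).ne'
  simp [h]

theorem continuous_setIntegral_Ioi {f : ℝ → ℝ} (hf : Integrable f) :
    Continuous fun β => ∫ x in Ioi β, f x := by
  have h : (fun β => ∫ x in Ioi β, f x) =
      fun β => (∫ x in Ioi (0 : ℝ), f x) - ∫ x in (0 : ℝ)..β, f x := by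
    funext β
    rw [← intervalIntegral.integral_Ioi_sub_Ioi' (a := 0) (b := β) hf.integrableOn
      hf.integrableOn, sub_sub_cancel]
  rw [h]
  exact continuous_const.sub
    (intervalIntegral.continuous_primitive (fun _ _ => hf.intervalIntegrable) 0)

theorem setIntegral_Ioi_zero_comp_add_right (f : ℝ → ℝ) (a : ℝ) :
    ∫ t in Ioi (0 : ℝ), f (t + a) = ∫ x in Ioi a, f x := by
  have h := (measurePreserving_add_right volume a).setIntegral_preimage_emb
    (measurableEmbedding_addRight a) f (Ioi a)
  simpa using h

theorem integrable_id_mul_comp_add_right {p : ℝ → ℝ} (hp : Integrable p)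
    (hp₁ : Integrable (fun x => x * p x)) (β : ℝ) : Integrable (fun t => t * p (t + β)) := by
  refine ((hp₁.comp_add_right β).sub ((hp.comp_add_right β).const_mul β)).congr
    (Filter.Eventually.of_forall fun t => ?_)
  simp only [Pi.sub_apply]
  ring

theorem continuous_meanExcess {p : ℝ → ℝ} (hp : Integrable p) (hpos : ∀ x, 0 < p x)
    (hp₁ : Integrable (fun x => x * p x)) : Continuous (meanExcess p) :=
  ((continuous_setIntegral_Ioi hp₁).div (continuous_setIntegral_Ioi hp)
    fun _ => (setIntegral_Ioi_pos hp fun x _ => hpos x).ne').sub continuous_id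

theorem meanExcess_eq {p : ℝ → ℝ} (hp : Integrable p) (hpos : ∀ x, 0 < p x)
    (hp₁ : Integrable (fun x => x * p x)) (β : ℝ) :
    meanExcess p β =
      (∫ t in Ioi (0 : ℝ), t * p (t + β)) / ∫ t in Ioi (0 : ℝ), p (t + β) := by
  have hB := setIntegral_Ioi_pos (a := β) hp fun x _ => hpos x
  have h : ∫ t in Ioi (0 : ℝ), t * p (t + β) =
      (∫ x in Ioi β, x * p x) - β * ∫ x in Ioi β, p x := by
    rw [← integral_const_mul, ← integral_sub hp₁.integrableOn (hp.const_mul β).integrableOn,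
      ← setIntegral_Ioi_zero_comp_add_right _ β]
    congr 1
    funext t
    ring
  rw [h, setIntegral_Ioi_zero_comp_add_right p β, meanExcess]
  field_simp

theorem meanExcess_pos {p : ℝ → ℝ} (hp : Integrable p) (hpos : ∀ x, 0 < p x)
    (hp₁ : Integrable (fun x => x * p x)) (β : ℝ) : 0 < meanExcess p β := by
  rw [meanExcess_eq hp hpos hp₁]
  exact div_pos
    (setIntegral_Ioi_pos (integrable_id_mul_comp_add_right hp hp₁ β)
      fun t ht => mul_pos ht (hpos _))
    (setIntegral_Ioi_pos (hp.comp_add_right β) fun t _ => hpos _)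

/-- Translates of a positive log-concave function have monotone likelihood ratio. -/
theorem mul_le_mul_of_log_concave {p : ℝ → ℝ} (hpos : ∀ x, 0 < p x)
    (hlc : ∀ x y θ : ℝ, 0 ≤ θ → θ ≤ 1 → p x ^ θ * p y ^ (1 - θ) ≤ p (θ * x + (1 - θ) * y))
    {a b s t : ℝ} (hab : a ≤ b) (hst : s ≤ t) :
    p (s + a) * p (t + b) ≤ p (t + a) * p (s + b) := by
  rcases hab.eq_or_lt with rfl | hab
  · rw [mul_comm]
  have hD : 0 < (b - a) + (t - s) := by linarith
  set θ := (b - a) / ((b - a) + (t - s)) with hθ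
  have h0 : 0 ≤ θ := div_nonneg (by linarith) hD.le
  have h1 : θ ≤ 1 := (div_le_one hD).2 (by linarith)
  have hθD : θ * ((b - a) + (t - s)) = b - a := div_mul_cancel₀ _ hD.ne'
  have e1 : θ * (s + a) + (1 - θ) * (t + b) = t + a := by linarith
  have e2 : (1 - θ) * (s + a) + (1 - (1 - θ)) * (t + b) = s + b := by linarith
  have k1 := hlc (s + a) (t + b) θ h0 h1
  have k2 := hlc (s + a) (t + b) (1 - θ) (by linarith) (by linarith)
  rw [e1] at k1
  rw [e2, sub_sub_cancel] at k2
  have hx := Real.rpow_add (hpos (s + a)) θ (1 - θ)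
  have hy := Real.rpow_add (hpos (t + b)) θ (1 - θ)
  rw [add_sub_cancel, Real.rpow_one] at hx hy
  calc p (s + a) * p (t + b)
      = (p (s + a) ^ θ * p (t + b) ^ (1 - θ)) * (p (s + a) ^ (1 - θ) * p (t + b) ^ θ) := by
        conv_lhs => rw [hx, hy]
        ring
    _ ≤ p (t + a) * p (s + b) :=
        mul_le_mul k1 k2 (mul_nonneg (Real.rpow_nonneg (hpos _).le _)
          (Real.rpow_nonneg (hpos _).le _)) (hpos _).le

/-- The mean excess of a log-concave density is nonincreasing. -/
theorem antitone_meanExcess {p : ℝ → ℝ} (hp : Integrable p) (hpos : ∀ x, 0 < p x)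
    (hp₁ : Integrable (fun x => x * p x))
    (hlc : ∀ x y θ : ℝ, 0 ≤ θ → θ ≤ 1 → p x ^ θ * p y ^ (1 - θ) ≤ p (θ * x + (1 - θ) * y)) :
    Antitone (meanExcess p) := by
  intro a b hab
  have hi : ∀ β, Integrable (fun t => p (t + β)) := fun β => hp.comp_add_right β
  have hi₁ := integrable_id_mul_comp_add_right hp hp₁
  have hd : ∀ β u v, Integrable (fun t => u * (t * p (t + β)) - v * p (t + β)) :=
    fun β u v => ((hi₁ β).const_mul u).sub ((hi β).const_mul v)
  have hF := setIntegral_Ioi_pos (a := 0) (hi a) fun x _ => hpos _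
  have hE := setIntegral_Ioi_pos (a := 0) (hi b) fun x _ => hpos _
  have hc := meanExcess_eq hp hpos hp₁ b
  set c := meanExcess p b
  rw [eq_div_iff hE.ne'] at hc
  rw [meanExcess_eq hp hpos hp₁ a, le_div_iff₀ hF]
  have hpt : ∀ t, 0 ≤ (p (c + b) * (t * p (t + a)) - c * p (c + b) * p (t + a)) -
      (p (c + a) * (t * p (t + b)) - c * p (c + a) * p (t + b)) := fun t => by
    rcases le_total c t with h | h
    · have := mul_le_mul_of_log_concave hpos hlc hab h
      nlinarith [mul_nonneg (sub_nonneg.2 h) (sub_nonneg.2 this)]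
    · have := mul_le_mul_of_log_concave hpos hlc hab h
      nlinarith [mul_nonneg (sub_nonneg.2 h) (sub_nonneg.2 this)]
  have hI : 0 ≤ ∫ t in Ioi (0 : ℝ),
      (p (c + b) * (t * p (t + a)) - c * p (c + b) * p (t + a)) -
      (p (c + a) * (t * p (t + b)) - c * p (c + a) * p (t + b)) := integral_nonneg hpt
  rw [integral_sub (hd a _ _).integrableOn (hd b _ _).integrableOn,
    integral_sub ((hi₁ a).const_mul _).integrableOn ((hi a).const_mul _).integrableOn,
    integral_sub ((hi₁ b).const_mul _).integrableOn ((hi b).const_mul _).integrableOn,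
    integral_const_mul, integral_const_mul, integral_const_mul, integral_const_mul, ← hc] at hI
  refine le_of_mul_le_mul_left ?_ (hpos (c + b))
  linarith

/-- A positive continuous antitone function crosses a line of positive slope through the origin
exactly once on `[0, ∞)`, and does so at a positive point. -/
theorem Antitone.exists_pos_eq_mul {g : ℝ → ℝ} (hg : Antitone g) (hcont : Continuous g)
    (h0 : 0 < g 0) {k : ℝ} (hk : 0 < k) :
    ∃ x, 0 < x ∧ k * x = g x ∧ ∀ y, k * y = g y → y = x := by
  have hM : 0 ≤ g 0 / k := (div_pos h0 hk).le
  obtain ⟨x, hx, hxe⟩ : (0 : ℝ) ∈ (fun x => k * x - g x) '' Icc 0 (g 0 / k) := by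
    refine intermediate_value_Icc hM (by fun_prop) ⟨by simpa using h0.le, ?_⟩
    have := hg hM
    simp only [mul_div_cancel₀ _ hk.ne']
    linarith
  have hxe : k * x = g x := sub_eq_zero.1 hxe
  refine ⟨x, hx.1.lt_of_ne ?_, hxe, fun y hy => ?_⟩
  · rintro rfl
    rw [mul_zero] at hxe
    exact h0.ne hxe
  · rcases lt_trichotomy y x with h | h | h
    · have := hg h.le
      have := mul_lt_mul_of_pos_left h hk
      linarith
    · exact h
    · have := hg h.le
      have := mul_lt_mul_of_pos_left h hk
      linarith

open MeasureTheory Set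

/-- Remark 10: even with zero communication cost, the fixed-point equation
β² = (1/(γ+1))·G(β)² has exactly one solution in [0,∞), and it is strictly
positive. -/
theorem stmt17
    (p : ℝ → ℝ)
    (hmeas : Measurable p)
    (hnonneg : ∀ x, 0 ≤ p x)
    (hint : (∫ x, p x) = 1)
    (heven : ∀ x, p (-x) = p x)
    (hpos : ∀ x, 0 < p x)
    (hlogconcave : ∀ x y θ : ℝ, 0 ≤ θ → θ ≤ 1 →
      p x ^ θ * p y ^ (1 - θ) ≤ p (θ * x + (1 - θ) * y))
    (hC1 : ContDiffOn ℝ 1 p (Ioi 0))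
    (hmom2 : Integrable (fun x => x ^ 2 * p x))
    (γ : ℝ) (hγ : 0 < γ)
    (G : ℝ → ℝ)
    (hG : ∀ β, G β = (∫ x in Ioi β, x * p x) / (∫ x in Ioi β, p x) - β) :
    ∃ βstar : ℝ, 0 ≤ βstar ∧
      βstar ^ 2 = 1 / (γ + 1) * G βstar ^ 2 ∧
      (∀ β : ℝ, 0 ≤ β → β ^ 2 = 1 / (γ + 1) * G β ^ 2 → β = βstar) ∧
      0 < βstar := by
  have hp : Integrable p := by
    by_contra h
    rw [integral_undef h] at hint
    exact zero_ne_one hint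
  have hp₁ := integrable_id_mul_of_integrable_sq_mul hp hnonneg hmom2
  obtain rfl : G = meanExcess p := funext hG
  have hγ₁ : 0 < γ + 1 := by linarith
  have hk : 0 < √(γ + 1) := Real.sqrt_pos.2 hγ₁
  have hiff : ∀ β : ℝ, 0 ≤ β →
      (β ^ 2 = 1 / (γ + 1) * meanExcess p β ^ 2 ↔ √(γ + 1) * β = meanExcess p β) := by
    intro β hβ
    rw [← sq_eq_sq₀ (mul_nonneg hk.le hβ) (meanExcess_pos hp hpos hp₁ β).le, mul_pow,
      Real.sq_sqrt hγ₁.le, one_div, eq_inv_mul_iff_mul_eq₀ hγ₁.ne']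
  obtain ⟨x, hx, hxe, huniq⟩ := (antitone_meanExcess hp hpos hp₁ hlogconcave).exists_pos_eq_mul
    (continuous_meanExcess hp hpos hp₁) (meanExcess_pos hp hpos hp₁ 0) hk
  exact ⟨x, hx.le, (hiff x hx.le).2 hxe, fun β hβ h => huniq β ((hiff β hβ).1 h), hx⟩
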